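/- Let y ∈ ℝ^N, let X be a real N×p matrix, let σ² > 0, let λ > 0, let d₁,…,d_K ∈ ℝ^p, and let F₁,…,F_L be symmetric positive semidefinite real p×p matrices with stacked matrix D̄. Then the Bayesian linear-model posterior kernel β ↦ exp(−‖y − Xβ‖₂²/(2σ²)) · exp(−λ(∑_{k=1}^K |dₖᵀβ| + ∑_{ℓ=1}^L √(βᵀF_ℓβ))) is Lebesgue-integrable over ℝ^p if and only if the constrained least-squares problem minimize ‖y − Xβ‖₂² subject to dₖᵀβ = 0 for all k and βᵀF_ℓβ = 0 for all ℓ has a unique minimizer. That is, for the linear likelihood, existence and uniqueness of the MLE of the maximally sparse model is necessary and sufficient for posterior propriety. -/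

import Mathlib

open MeasureTheory Matrix

section NormedSpace

variable {E : Type*} [NormedAddCommGroup E] [NormedSpace ℝ E]

/-- A continuous, absolutely homogeneous function that is positive away from the origin
dominates a positive multiple of the norm. -/
theorem exists_pos_mul_norm_le_of_homogeneous [FiniteDimensional ℝ E] {g : E → ℝ}
    (hcont : Continuous g)
    (hhom : ∀ (t : ℝ) (x : E), g (t • x) = |t| * g x) (hpos : ∀ x, x ≠ 0 → 0 < g x) :
    ∃ c, 0 < c ∧ ∀ x, c * ‖x‖ ≤ g x := by
  have hg0 : g 0 = 0 := by simpa using hhom 0 0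
  rcases subsingleton_or_nontrivial E with hE | hE
  · refine ⟨1, one_pos, fun x => ?_⟩
    simp [Subsingleton.elim x 0, hg0]
  have : ProperSpace E := FiniteDimensional.proper ℝ E
  obtain ⟨x₀, hx₀, hmin⟩ := (isCompact_sphere (0 : E) 1).exists_isMinOn
    (NormedSpace.sphere_nonempty.2 zero_le_one) hcont.continuousOn
  have hx₀' : x₀ ≠ 0 := by
    rintro rfl
    simp at hx₀
  refine ⟨g x₀, hpos x₀ hx₀', fun x => ?_⟩
  rcases eq_or_ne x 0 with rfl | hx
  · simp [hg0]
  have hnx : 0 < ‖x‖ := norm_pos_iff.2 hx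
  have hle : g x₀ ≤ g (‖x‖⁻¹ • x) :=
    hmin (by simp [norm_smul, hnx.ne'])
  rw [hhom, abs_of_pos (inv_pos.2 hnx)] at hle
  calc g x₀ * ‖x‖ ≤ ‖x‖⁻¹ * g x * ‖x‖ := by gcongr
    _ = g x := by field_simp

variable [MeasurableSpace E] [BorelSpace E] (μ : Measure E) [μ.IsAddHaarMeasure]

theorem integrable_exp_neg_mul_norm [FiniteDimensional ℝ E] {c : ℝ} (hc : 0 < c) :
    Integrable (fun x : E => Real.exp (-(c * ‖x‖))) μ := by
  set k : ℕ := Module.finrank ℝ E + 1 with hk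
  have hint : Integrable (fun x : E => (1 + ‖x‖) ^ (-(k : ℝ))) μ :=
    integrable_one_add_norm (by rw [hk]; push_cast; linarith)
  refine (hint.const_mul (Real.exp c * k.factorial / c ^ k)).mono'
    (by fun_prop) (Filter.Eventually.of_forall fun x => ?_)
  have hpos : 0 < 1 + ‖x‖ := by positivity
  rw [Real.norm_of_nonneg (Real.exp_nonneg _), Real.rpow_neg hpos.le, Real.rpow_natCast]
  have hexp := Real.pow_div_factorial_le_exp (c * (1 + ‖x‖)) (by positivity) k
  rw [div_le_iff₀ (by positivity), mul_pow] at hexp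
  have hsplit : Real.exp (c * (1 + ‖x‖)) * Real.exp (-(c * ‖x‖)) = Real.exp c := by
    rw [← Real.exp_add]
    ring_nf
  rw [← div_eq_mul_inv, div_div, le_div_iff₀ (by positivity)]
  calc Real.exp (-(c * ‖x‖)) * (c ^ k * (1 + ‖x‖) ^ k)
      ≤ Real.exp (-(c * ‖x‖)) * (Real.exp (c * (1 + ‖x‖)) * k.factorial) := by gcongr
    _ = Real.exp c * k.factorial := by rw [← hsplit]; ring

/-- By Poincaré recurrence, a positive function with a nonzero period is not integrable. -/
theorem eq_zero_of_integrable_of_periodic {f : E → ℝ} (hf : Measurable f) (hpos : ∀ x, 0 < f x)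
    (hint : Integrable f μ) {v : E} (hv : ∀ x, f (x + v) = f x) : v = 0 := by
  by_contra hne
  set ν : Measure E := μ.withDensity fun x => ENNReal.ofReal (f x)
  have hfm : Measurable fun x => ENNReal.ofReal (f x) := hf.ennreal_ofReal
  have : IsFiniteMeasure ν := isFiniteMeasure_withDensity_ofReal hint.2
  have hpres : MeasurePreserving (fun x => x + v) ν ν := by
    refine ⟨measurable_add_const v, Measure.ext fun s hs => ?_⟩
    have hadd := measurePreserving_add_right μ v
    rw [Measure.map_apply (measurable_add_const v) hs,
      withDensity_apply _ (measurable_add_const v hs), withDensity_apply _ hs,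
      ← hadd.setLIntegral_comp_preimage hs hfm]
    simp only [hv]
  have hball : ν (Metric.ball 0 (‖v‖ / 2)) ≠ 0 := by
    intro h0
    rw [withDensity_apply_eq_zero' hfm.aemeasurable] at h0
    have hset : {x | ENNReal.ofReal (f x) ≠ 0} = Set.univ := by
      ext x
      simp [hpos x]
    rw [hset, Set.univ_inter] at h0
    exact (Metric.measure_ball_pos μ 0 (half_pos (norm_pos_iff.2 hne))).ne' h0
  obtain ⟨x, hx, m, hm, hmx⟩ :=
    hpres.exists_mem_iterate_mem Metric.isOpen_ball.measurableSet.nullMeasurableSet hball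
  rw [add_right_iterate_apply, mem_ball_zero_iff] at hmx
  rw [mem_ball_zero_iff] at hx
  have hlt : ‖m • v‖ < ‖v‖ := by
    calc ‖m • v‖ = ‖(x + m • v) - x‖ := by simp
      _ ≤ ‖x + m • v‖ + ‖x‖ := norm_sub_le _ _
      _ < ‖v‖ := by linarith
  rw [← Nat.cast_smul_eq_nsmul ℝ, norm_smul, Real.norm_natCast] at hlt
  have hm1 : (1 : ℝ) ≤ m := by exact_mod_cast Nat.one_le_iff_ne_zero.2 hm
  nlinarith [norm_nonneg v]

end NormedSpace

section QuadraticForm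

variable {n : Type*} [Fintype n] {A : Matrix n n ℝ}

theorem Matrix.PosSemidef.dotProduct_mulVec_eq_zero_iff (hA : A.PosSemidef) (x : n → ℝ) :
    x ⬝ᵥ A *ᵥ x = 0 ↔ A *ᵥ x = 0 := by
  simpa using hA.dotProduct_mulVec_zero_iff x

theorem Matrix.IsSymm.dotProduct_mulVec_add_of_mulVec_eq_zero (hA : A.IsSymm) {v : n → ℝ}
    (hv : A *ᵥ v = 0) (x : n → ℝ) : (x + v) ⬝ᵥ A *ᵥ (x + v) = x ⬝ᵥ A *ᵥ x := by
  have h : v ⬝ᵥ A *ᵥ x = 0 := by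
    rw [dotProduct_mulVec, ← mulVec_transpose, hA.eq, hv, zero_dotProduct]
  rw [mulVec_add, hv, add_zero, add_dotProduct, h, add_zero]

theorem sqrt_dotProduct_mulVec_smul (A : Matrix n n ℝ) (t : ℝ) (x : n → ℝ) :
    Real.sqrt ((t • x) ⬝ᵥ A *ᵥ (t • x)) = |t| * Real.sqrt (x ⬝ᵥ A *ᵥ x) := by
  rw [mulVec_smul, dotProduct_smul, smul_dotProduct, smul_smul, smul_eq_mul,
    Real.sqrt_mul (mul_self_nonneg t), Real.sqrt_mul_self_eq_abs]

end QuadraticForm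

section SparseModel

variable {N p K L : ℕ} (y : Fin N → ℝ) (X : Matrix (Fin N) (Fin p) ℝ)
  (d : Fin K → (Fin p → ℝ)) (F : Fin L → Matrix (Fin p) (Fin p) ℝ)

/-- The design matrix is injective on the null space of the structured sparse restrictions. -/
def IdentifiedOnNullSpace : Prop :=
  ∀ v : Fin p → ℝ, X *ᵥ v = 0 → (∀ k, d k ⬝ᵥ v = 0) → (∀ ℓ, v ⬝ᵥ (F ℓ) *ᵥ v = 0) → v = 0

variable {X d F}

/-- Under identification, the negative log posterior grows at least linearly. -/
theorem IdentifiedOnNullSpace.exists_mul_norm_sub_le (h : IdentifiedOnNullSpace X d F)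
    (hF : ∀ ℓ, (F ℓ).PosSemidef) {σ2 lam : ℝ} (hσ2 : 0 < σ2) (hlam : 0 < lam) :
    ∃ c C : ℝ, 0 < c ∧ ∀ β : Fin p → ℝ,
      c * ‖β‖ - C ≤ (∑ n, (y n - (X *ᵥ β) n) ^ 2) / (2 * σ2) +
        lam * ((∑ k, |d k ⬝ᵥ β|) + ∑ ℓ, Real.sqrt (β ⬝ᵥ (F ℓ) *ᵥ β)) := by
  have hX0 : ∀ β : Fin p → ℝ, 0 ≤ ∑ n, |(X *ᵥ β) n| := fun β => by positivity
  have hd0 : ∀ β : Fin p → ℝ, 0 ≤ ∑ k, |d k ⬝ᵥ β| := fun β => by positivity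
  have hF0 : ∀ β : Fin p → ℝ, 0 ≤ ∑ ℓ, Real.sqrt (β ⬝ᵥ (F ℓ) *ᵥ β) := fun β => by positivity
  obtain ⟨c, hc, hle⟩ := exists_pos_mul_norm_le_of_homogeneous
    (g := fun β : Fin p → ℝ => (∑ n, |(X *ᵥ β) n|) + (∑ k, |d k ⬝ᵥ β|) +
      ∑ ℓ, Real.sqrt (β ⬝ᵥ (F ℓ) *ᵥ β)) (by fun_prop)
    (fun t β => by
      simp only [sqrt_dotProduct_mulVec_smul]
      simp only [mulVec_smul, dotProduct_smul, Pi.smul_apply,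
        smul_eq_mul, abs_mul, ← Finset.mul_sum, mul_add])
    (fun β hβ => by
      refine lt_of_le_of_ne (add_nonneg (add_nonneg (hX0 β) (hd0 β)) (hF0 β)) fun h0 => hβ ?_
      have hX' : ∑ n, |(X *ᵥ β) n| = 0 := by linarith [hX0 β, hd0 β, hF0 β]
      have hd' : ∑ k, |d k ⬝ᵥ β| = 0 := by linarith [hX0 β, hd0 β, hF0 β]
      have hF' : ∑ ℓ, Real.sqrt (β ⬝ᵥ (F ℓ) *ᵥ β) = 0 := by linarith [hX0 β, hd0 β, hF0 β]
      rw [Finset.sum_eq_zero_iff_of_nonneg fun _ _ => by positivity] at hX' hd' hF'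
      refine h β (funext fun n => abs_eq_zero.1 (hX' n (Finset.mem_univ n)))
        (fun k => abs_eq_zero.1 (hd' k (Finset.mem_univ k))) fun ℓ => ?_
      have hq : 0 ≤ β ⬝ᵥ (F ℓ) *ᵥ β := by simpa using (hF ℓ).dotProduct_mulVec_nonneg β
      exact (Real.sqrt_eq_zero hq).1 (hF' ℓ (Finset.mem_univ ℓ)))
  refine ⟨lam * c, ∑ n, (lam * |y n| + σ2 * lam ^ 2 / 2), mul_pos hlam hc, fun β => ?_⟩
  have hsq : ∀ n, lam * |(X *ᵥ β) n| - (lam * |y n| + σ2 * lam ^ 2 / 2) ≤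
      (y n - (X *ᵥ β) n) ^ 2 / (2 * σ2) := by
    intro n
    rw [le_div_iff₀ (by positivity), ← sq_abs (y n - (X *ᵥ β) n)]
    have htri : |(X *ᵥ β) n| - |y n| ≤ |y n - (X *ᵥ β) n| := by
      rw [abs_sub_comm]
      exact abs_sub_abs_le_abs_sub _ _
    nlinarith [sq_nonneg (|y n - (X *ᵥ β) n| - σ2 * lam),
      mul_le_mul_of_nonneg_left htri (mul_pos hσ2 hlam).le]
  have hsum := Finset.sum_le_sum fun n (_ : n ∈ Finset.univ) => hsq n
  rw [Finset.sum_sub_distrib, ← Finset.mul_sum, ← Finset.sum_div] at hsum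
  have := mul_le_mul_of_nonneg_left (hle β) hlam.le
  simp only [mul_add] at this ⊢
  linarith

theorem IdentifiedOnNullSpace.integrable_posterior (h : IdentifiedOnNullSpace X d F)
    (hF : ∀ ℓ, (F ℓ).PosSemidef) {σ2 lam : ℝ} (hσ2 : 0 < σ2) (hlam : 0 < lam) :
    Integrable (fun β : Fin p → ℝ =>
        Real.exp (-(∑ n, (y n - (X *ᵥ β) n) ^ 2) / (2 * σ2)) *
          Real.exp (-(lam * ((∑ k, |d k ⬝ᵥ β|) +
            ∑ ℓ, Real.sqrt (β ⬝ᵥ (F ℓ) *ᵥ β))))) volume := by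
  obtain ⟨c, C, hc, hle⟩ := h.exists_mul_norm_sub_le y hF hσ2 hlam
  refine ((integrable_exp_neg_mul_norm volume hc).const_mul (Real.exp C)).mono'
    (Continuous.aestronglyMeasurable (by fun_prop)) (Filter.Eventually.of_forall fun β => ?_)
  rw [Real.norm_of_nonneg (by positivity), ← Real.exp_add, ← Real.exp_add, Real.exp_le_exp,
    neg_div]
  linarith [hle β]

theorem identifiedOnNullSpace_of_integrable_posterior (hsymm : ∀ ℓ, (F ℓ).IsSymm)
    (hF : ∀ ℓ, (F ℓ).PosSemidef) {σ2 lam : ℝ}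
    (hint : Integrable (fun β : Fin p → ℝ =>
        Real.exp (-(∑ n, (y n - (X *ᵥ β) n) ^ 2) / (2 * σ2)) *
          Real.exp (-(lam * ((∑ k, |d k ⬝ᵥ β|) +
            ∑ ℓ, Real.sqrt (β ⬝ᵥ (F ℓ) *ᵥ β))))) volume) :
    IdentifiedOnNullSpace X d F := by
  intro v hXv hdv hFv
  refine eq_zero_of_integrable_of_periodic volume (Continuous.measurable (by fun_prop))
    (fun β => by positivity) hint fun β => ?_
  have hquad : ∀ ℓ, (β + v) ⬝ᵥ (F ℓ) *ᵥ (β + v) = β ⬝ᵥ (F ℓ) *ᵥ β := fun ℓ =>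
    (hsymm ℓ).dotProduct_mulVec_add_of_mulVec_eq_zero
      (((hF ℓ).dotProduct_mulVec_eq_zero_iff v).1 (hFv ℓ)) β
  simp only [hquad]
  simp only [mulVec_add, hXv, dotProduct_add, hdv, add_zero]

theorem IdentifiedOnNullSpace.existsUnique_minimizer (h : IdentifiedOnNullSpace X d F)
    (hF : ∀ ℓ, (F ℓ).PosSemidef) :
    ∃! β₀ : Fin p → ℝ,
      ((∀ k, d k ⬝ᵥ β₀ = 0) ∧ (∀ ℓ, β₀ ⬝ᵥ (F ℓ) *ᵥ β₀ = 0)) ∧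
        ∀ β : Fin p → ℝ, (∀ k, d k ⬝ᵥ β = 0) → (∀ ℓ, β ⬝ᵥ (F ℓ) *ᵥ β = 0) →
          (∑ n, (y n - (X *ᵥ β₀) n) ^ 2) ≤ ∑ n, (y n - (X *ᵥ β) n) ^ 2 := by
  obtain ⟨c, C, hc, hle⟩ := h.exists_mul_norm_sub_le y hF (one_half_pos (α := ℝ)) one_pos
  set S : Set (Fin p → ℝ) := {β | (∀ k, d k ⬝ᵥ β = 0) ∧ ∀ ℓ, β ⬝ᵥ (F ℓ) *ᵥ β = 0} with hS
  have hclosed : IsClosed S := by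
    simp only [hS, Set.ofPred_and, Set.ofPred_forall]
    exact (isClosed_iInter fun k => isClosed_eq (by fun_prop) continuous_const).inter
      (isClosed_iInter fun ℓ => isClosed_eq (by fun_prop) continuous_const)
  have hgrow : ∀ β ∈ S, c * ‖β‖ - C ≤ ∑ n, (y n - (X *ᵥ β) n) ^ 2 := by
    intro β hβ
    simpa [hβ.1, hβ.2] using hle β
  have hevent : ∀ᶠ β in Filter.cocompact (Fin p → ℝ) ⊓ Filter.principal S,
      ∑ n, (y n - (X *ᵥ (0 : Fin p → ℝ)) n) ^ 2 ≤ ∑ n, (y n - (X *ᵥ β) n) ^ 2 := by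
    rw [Filter.eventually_inf_principal]
    filter_upwards [(tendsto_norm_cocompact_atTop (E := Fin p → ℝ)).eventually_ge_atTop
      ((∑ n, (y n - (X *ᵥ (0 : Fin p → ℝ)) n) ^ 2 + C) / c)] with β hβ hβS
    rw [div_le_iff₀ hc] at hβ
    linarith [hgrow β hβS]
  obtain ⟨β₀, hβ₀, hmin⟩ := ContinuousOn.exists_isMinOn' (s := S)
    (f := fun β : Fin p → ℝ => ∑ n, (y n - (X *ᵥ β) n) ^ 2)
    (Continuous.continuousOn (by fun_prop)) hclosed (x₀ := 0) (by simp [hS]) hevent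
  refine ⟨β₀, ⟨hβ₀, fun β hd hq => hmin (show β ∈ S from ⟨hd, hq⟩)⟩, ?_⟩
  rintro β₁ ⟨⟨hd₁, hq₁⟩, hmin₁⟩
  simp only [(hF _).dotProduct_mulVec_eq_zero_iff] at hq₁
  have hd₀ := hβ₀.1
  have hq₀ : ∀ ℓ, F ℓ *ᵥ β₀ = 0 := fun ℓ =>
    ((hF ℓ).dotProduct_mulVec_eq_zero_iff β₀).1 (hβ₀.2 ℓ)
  have hle₁₀ := hmin₁ β₀ hβ₀.1 hβ₀.2
  have hmid := hmin (show (1 / 2 : ℝ) • (β₁ + β₀) ∈ S from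
    ⟨fun k => by simp [dotProduct_add, hd₁, hd₀],
      fun ℓ => by simp [mulVec_smul, mulVec_add, hq₁, hq₀]⟩)
  have hpar : 4 * ∑ n, (y n - (X *ᵥ ((1 / 2 : ℝ) • (β₁ + β₀))) n) ^ 2 +
      ∑ n, ((X *ᵥ (β₁ - β₀)) n) ^ 2 =
      2 * ∑ n, (y n - (X *ᵥ β₁) n) ^ 2 + 2 * ∑ n, (y n - (X *ᵥ β₀) n) ^ 2 := by
    simp only [Finset.mul_sum, ← Finset.sum_add_distrib, mulVec_smul, mulVec_add, mulVec_sub,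
      Pi.smul_apply, Pi.add_apply, Pi.sub_apply, smul_eq_mul]
    exact Finset.sum_congr rfl fun n _ => by ring
  have hnonneg : 0 ≤ ∑ n, ((X *ᵥ (β₁ - β₀)) n) ^ 2 := by positivity
  have hzero : ∑ n, ((X *ᵥ (β₁ - β₀)) n) ^ 2 = 0 := by
    have hmid' : ∑ n, (y n - (X *ᵥ β₀) n) ^ 2 ≤
      ∑ n, (y n - (X *ᵥ ((1 / 2 : ℝ) • (β₁ + β₀))) n) ^ 2 := hmid
    linarith
  rw [Finset.sum_eq_zero_iff_of_nonneg fun _ _ => by positivity] at hzero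
  refine sub_eq_zero.1 (h _ (funext fun n => pow_eq_zero_iff two_ne_zero |>.1
    (hzero n (Finset.mem_univ n))) (fun k => by simp [dotProduct_sub, hd₁, hd₀])
    fun ℓ => by simp [mulVec_sub, hq₁, hq₀])

theorem identifiedOnNullSpace_of_existsUnique_minimizer (hsymm : ∀ ℓ, (F ℓ).IsSymm)
    (hF : ∀ ℓ, (F ℓ).PosSemidef)
    (h : ∃! β₀ : Fin p → ℝ,
      ((∀ k, d k ⬝ᵥ β₀ = 0) ∧ (∀ ℓ, β₀ ⬝ᵥ (F ℓ) *ᵥ β₀ = 0)) ∧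
        ∀ β : Fin p → ℝ, (∀ k, d k ⬝ᵥ β = 0) → (∀ ℓ, β ⬝ᵥ (F ℓ) *ᵥ β = 0) →
          (∑ n, (y n - (X *ᵥ β₀) n) ^ 2) ≤ ∑ n, (y n - (X *ᵥ β) n) ^ 2) :
    IdentifiedOnNullSpace X d F := by
  intro v hXv hdv hFv
  obtain ⟨β₀, ⟨⟨hd₀, hq₀⟩, hmin⟩, huniq⟩ := h
  have hquad : ∀ ℓ, (β₀ + v) ⬝ᵥ (F ℓ) *ᵥ (β₀ + v) = 0 := fun ℓ => by
    rw [(hsymm ℓ).dotProduct_mulVec_add_of_mulVec_eq_zero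
      (((hF ℓ).dotProduct_mulVec_eq_zero_iff v).1 (hFv ℓ)), hq₀]
  have hshift := huniq (β₀ + v) ⟨⟨fun k => by rw [dotProduct_add, hd₀, hdv, add_zero], hquad⟩,
    fun β hd hq => by simpa [mulVec_add, hXv] using hmin β hd hq⟩
  simpa using hshift

end SparseModel

/-- For the linear likelihood, the posterior kernel with a structured sparse prior is
integrable over ℝ^p iff the constrained least-squares problem subject to all structured
sparse restrictions binding (the maximally sparse model) has a unique minimizer. -/
theorem linear_posterior_proper_iff_maximally_sparse_mle
    (N p K L : ℕ) (y : Fin N → ℝ) (X : Matrix (Fin N) (Fin p) ℝ)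
    (σ2 : ℝ) (hσ2 : 0 < σ2) (lam : ℝ) (hlam : 0 < lam)
    (d : Fin K → (Fin p → ℝ))
    (F : Fin L → Matrix (Fin p) (Fin p) ℝ)
    (hFsymm : ∀ ℓ, (F ℓ).IsSymm)
    (hFpsd : ∀ ℓ, (F ℓ).PosSemidef) :
    Integrable (fun β : Fin p → ℝ =>
        Real.exp (-(∑ n, (y n - (X *ᵥ β) n) ^ 2) / (2 * σ2)) *
          Real.exp (-(lam * ((∑ k, |d k ⬝ᵥ β|) +
            ∑ ℓ, Real.sqrt (β ⬝ᵥ (F ℓ) *ᵥ β))))) volume ↔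
      ∃! β₀ : Fin p → ℝ,
        ((∀ k, d k ⬝ᵥ β₀ = 0) ∧ (∀ ℓ, β₀ ⬝ᵥ (F ℓ) *ᵥ β₀ = 0)) ∧
          ∀ β : Fin p → ℝ, (∀ k, d k ⬝ᵥ β = 0) → (∀ ℓ, β ⬝ᵥ (F ℓ) *ᵥ β = 0) →
            (∑ n, (y n - (X *ᵥ β₀) n) ^ 2) ≤ ∑ n, (y n - (X *ᵥ β) n) ^ 2 := by
  exact ⟨fun hint =>
      (identifiedOnNullSpace_of_integrable_posterior y hFsymm hFpsd hint).existsUnique_minimizer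
        y hFpsd,
    fun h => (identifiedOnNullSpace_of_existsUnique_minimizer y hFsymm
      hFpsd h).integrable_posterior y hFpsd hσ2 hlam⟩
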